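/- For every β > 1 there exists a constant C > 0 such that L'_{β,n} ≤ C·β^n and L_{β,n} ≤ C·β^n for all n ≥ 1. -/

import Mathlib

open Filter Set

/-- The (−β)-transformation on [−β/(β+1), 1/(β+1)). -/
noncomputable def negBetaT (β : ℝ) (x : ℝ) : ℝ := -β * x - ⌊β / (β + 1) - β * x⌋

/-- The digits of the (−β)-expansion of x; `negBetaDigit β x n` is ε_{n+1}(x). -/
noncomputable def negBetaDigit (β : ℝ) (x : ℝ) (n : ℕ) : ℤ :=
  ⌊β / (β + 1) - β * ((negBetaT β)^[n] x)⌋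

/-- The (−β)-expansion of the left endpoint −β/(β+1); index n represents a_{n+1}. -/
noncomputable def negBetaExp (β : ℝ) (n : ℕ) : ℤ := negBetaDigit β (-β / (β + 1)) n

/-- `b` is the (−β)-expansion of `x`. -/
def IsNegBetaExpOf (β : ℝ) (x : ℝ) (b : ℕ → ℤ) : Prop :=
  x ∈ Set.Ico (-β / (β + 1)) (1 / (β + 1)) ∧ ∀ n, b n = negBetaDigit β x n

/-- Alternating lexicographic strict order (0-based indexing: index k corresponds
to position k+1, so `Even k` means odd position). -/
def AltLt (x y : ℕ → ℤ) : Prop :=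
  ∃ k, (∀ i, i < k → x i = y i) ∧ (if Even k then x k < y k else y k < x k)

/-- Alternating lexicographic order. -/
def AltLe (x y : ℕ → ℤ) : Prop := AltLt x y ∨ x = y

def phiW : ℕ → List ℕ
  | 1 => [1, 0, 0]
  | _ => [1]

/-- `uWord n` is φ^n(1), where φ(1) = 100, φ(0) = 1. -/
def uWord : ℕ → List ℕ
  | 0 => [1]
  | n + 1 => (uWord n).flatMap phiW

/-- The sequence u = 100111001001001110011⋯ starting with φ^n(1) for all n. -/
def uSeq (n : ℕ) : ℤ := ((uWord (n + 1)).getD n 0 : ℕ)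

/-- Condition (G): every shifted sequence is ≤_alt the sequence itself. -/
def CondG (a : ℕ → ℤ) : Prop := ∀ k, 1 ≤ k → AltLe (fun n => a (n + k)) a

/-- Condition (L): a >_alt u. -/
def CondL (a : ℕ → ℤ) : Prop := AltLt uSeq a

/-- The periodic sequence (w)^∞. -/
def perSeq (w : List ℤ) : ℕ → ℤ := fun n => w.getD (n % w.length) 0

/-- `a` is an infinite concatenation of blocks from `S`. -/
def IsInfConcat (S : Set (List ℤ)) (a : ℕ → ℤ) : Prop :=
  ∃ w : ℕ → List ℤ, (∀ n, w n ∈ S) ∧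
    ∀ N i, i < (((List.range N).map w).flatten).length →
      (((List.range N).map w).flatten).getD i 0 = a i

/-- Condition (A1). -/
def CondA1 (a : ℕ → ℤ) : Prop :=
  ∀ k, 1 ≤ k → AltLt uSeq (perSeq ((List.range k).map a)) →
    IsInfConcat {(List.range k).map a, (List.range (k - 1)).map a ++ [a (k - 1) - 1, 0]} a →
    a = perSeq ((List.range k).map a)

/-- Condition (A2). -/
def CondA2 (a : ℕ → ℤ) : Prop :=
  ∀ k, 1 ≤ k → AltLt uSeq (perSeq ((List.range (k - 1)).map a ++ [a (k - 1) + 1])) →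
    ¬ IsInfConcat {(List.range k).map a ++ [0], (List.range (k - 1)).map a ++ [a (k - 1) + 1]} a

/-- The cylinder set I_{b_1⋯b_n}. -/
def cylinder (β : ℝ) (w : List ℤ) : Set ℝ :=
  {x | x ∈ Set.Ico (-β / (β + 1)) (1 / (β + 1)) ∧
    ∀ i, i < w.length → negBetaDigit β x i = w.getD i 0}

/-- L_{β,n}: the number of words of length n with nonempty cylinder. -/
noncomputable def Lnum (β : ℝ) (n : ℕ) : ℕ :=
  Set.ncard {w : List ℤ | w.length = n ∧ (cylinder β w).Nonempty}

/-- L'_{β,n}: the number of words of length n whose cylinder is an interval of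
positive length. -/
noncomputable def Lnum' (β : ℝ) (n : ℕ) : ℕ :=
  Set.ncard {w : List ℤ | w.length = n ∧
    ∃ c d : ℝ, c < d ∧ Set.Ioo c d ⊆ cylinder β w ∧ cylinder β w ⊆ Set.Icc c d}

/-- P_n(x) = (−x)^n + Σ_{j=1}^n (a_j+1)(−x)^{n−j}. -/
noncomputable def Pn (a : ℕ → ℤ) (n : ℕ) (x : ℝ) : ℝ :=
  (-x) ^ n + ∑ j ∈ Finset.range n, ((a j : ℝ) + 1) * (-x) ^ (n - 1 - j)

/-- J_n = {x > 1 : P_j(x) ∈ [0,1] for all 1 ≤ j ≤ n}. -/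
def Jn (a : ℕ → ℤ) (n : ℕ) : Set ℝ :=
  {x | 1 < x ∧ ∀ j, 1 ≤ j → j ≤ n → Pn a j x ∈ Set.Icc (0 : ℝ) 1}

/-- The domain `[-β/(β+1), 1/(β+1))` of the (−β)-transformation. -/
def negBetaDom (β : ℝ) : Set ℝ := Set.Ico (-β / (β + 1)) (1 / (β + 1))

/-- The word formed by the first `n` digits of `x`. -/
noncomputable def negBetaWord (β : ℝ) (n : ℕ) (x : ℝ) : List ℤ :=
  (List.range n).map (negBetaDigit β x)

/-- The set of words of length `n` that occur as the first `n` digits of some point. -/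
def admissibleWords (β : ℝ) (n : ℕ) : Set (List ℤ) := negBetaWord β n '' negBetaDom β

lemma negBetaT_mem_dom {β : ℝ} (hβ : 1 < β) (x : ℝ) : negBetaT β x ∈ negBetaDom β := by
  have h0 := Int.floor_le (β / (β + 1) - β * x)
  have h1 := Int.lt_floor_add_one (β / (β + 1) - β * x)
  have h2 : 1 / (β + 1) = 1 - β / (β + 1) := by field_simp; ring
  have h3 : -β / (β + 1) = -(β / (β + 1)) := neg_div _ _
  simp only [negBetaDom, negBetaT, Set.mem_Ico, h2, h3]
  constructor <;> linarith

lemma negBetaT_iterate_mem_dom {β : ℝ} (hβ : 1 < β) {x : ℝ} (hx : x ∈ negBetaDom β) (n : ℕ) :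
    (negBetaT β)^[n] x ∈ negBetaDom β := by
  cases n with
  | zero => exact hx
  | succ n =>
    rw [Function.iterate_succ_apply']
    exact negBetaT_mem_dom hβ _

lemma negBetaDigit_mem_Icc {β : ℝ} (hβ : 1 < β) {x : ℝ} (hx : x ∈ negBetaDom β) (n : ℕ) :
    negBetaDigit β x n ∈ Set.Icc (0 : ℤ) ⌊β⌋ := by
  obtain ⟨h0, h1⟩ := negBetaT_iterate_mem_dom hβ hx n
  have e1 : β / (β + 1) = β * (1 / (β + 1)) := by ring
  have e2 : β / (β + 1) - β * (-β / (β + 1)) = β := by field_simp; ring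
  have hpos : 0 < β := by linarith
  constructor
  · apply Int.floor_nonneg.2
    nlinarith [mul_le_mul_of_nonneg_left h1.le hpos.le]
  · apply Int.floor_le_floor
    nlinarith [mul_le_mul_of_nonneg_left h0 hpos.le]

lemma negBetaWord_eq_iff {β : ℝ} {n : ℕ} {x y : ℝ} :
    negBetaWord β n x = negBetaWord β n y ↔
      ∀ i < n, negBetaDigit β x i = negBetaDigit β y i := by
  simp [negBetaWord]

lemma negBetaDigit_add (β x : ℝ) (n i : ℕ) :
    negBetaDigit β x (n + i) = negBetaDigit β ((negBetaT β)^[n] x) i := by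
  simp only [negBetaDigit]
  rw [add_comm n i, Function.iterate_add_apply]

lemma negBetaWord_add (β x : ℝ) (n m : ℕ) :
    negBetaWord β (n + m) x =
      negBetaWord β n x ++ negBetaWord β m ((negBetaT β)^[n] x) := by
  simp only [negBetaWord, List.range_add, List.map_append, List.map_map]
  congr 1
  exact List.map_congr_left fun i _ => negBetaDigit_add β x n i

lemma negBetaT_iterate_sub {β : ℝ} {x y : ℝ} {n : ℕ}
    (h : negBetaWord β n x = negBetaWord β n y) :
    (negBetaT β)^[n] y - (negBetaT β)^[n] x = (-β) ^ n * (y - x) := by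
  rw [negBetaWord_eq_iff] at h
  induction n with
  | zero => simp
  | succ n ih =>
    have h1 := ih fun i hi => h i (by omega)
    have h2 := h n (by omega)
    simp only [negBetaDigit] at h2
    rw [Function.iterate_succ_apply', Function.iterate_succ_apply']
    simp only [negBetaT] at h1 h2 ⊢
    rw [h2, pow_succ]
    linear_combination (-β) * h1

/-- Points lying between two points with the same first `n` digits share these digits. -/
lemma negBetaWord_eq_of_mem_Icc {β : ℝ} (hβ : 1 < β) {x y z : ℝ} {n : ℕ}
    (h : negBetaWord β n x = negBetaWord β n y) (hz : z ∈ Set.Icc x y) :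
    negBetaWord β n z = negBetaWord β n x := by
  induction n with
  | zero => rfl
  | succ n ih =>
    rw [negBetaWord_eq_iff] at h
    have hxy : negBetaWord β n x = negBetaWord β n y :=
      negBetaWord_eq_iff.2 fun i hi => h i (by omega)
    have hzx := ih hxy
    have e1 := negBetaT_iterate_sub hxy
    have e2 := negBetaT_iterate_sub hzx
    have hn := h n (by omega)
    rw [negBetaWord_eq_iff] at hzx ⊢
    intro i hi
    rcases Nat.lt_succ_iff_lt_or_eq.1 hi with hi | rfl
    · exact hzx i hi
    · obtain ⟨hz1, hz2⟩ := hz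
      have hpos : 0 < β := by linarith
      have key : ∀ {a b : ℝ}, a ≤ b →
          ⌊β / (β + 1) - β * b⌋ ≤ ⌊β / (β + 1) - β * a⌋ := fun hab =>
        Int.floor_le_floor (by nlinarith [mul_le_mul_of_nonneg_left hab hpos.le])
      simp only [negBetaDigit] at hn ⊢
      rcases le_total 0 ((-β) ^ i) with hs | hs
      · have k1 := key (show (negBetaT β)^[i] x ≤ (negBetaT β)^[i] z by nlinarith)
        have k2 := key (show (negBetaT β)^[i] z ≤ (negBetaT β)^[i] y by nlinarith)
        omega
      · have k1 := key (show (negBetaT β)^[i] z ≤ (negBetaT β)^[i] x by nlinarith)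
        have k2 := key (show (negBetaT β)^[i] y ≤ (negBetaT β)^[i] z by nlinarith)
        omega

lemma admissibleWords_finite {β : ℝ} (hβ : 1 < β) (n : ℕ) : (admissibleWords β n).Finite := by
  induction n with
  | zero =>
    refine (Set.finite_singleton ([] : List ℤ)).subset ?_
    rintro _ ⟨x, -, rfl⟩
    simp [negBetaWord]
  | succ n ih =>
    refine (Set.Finite.image2 (fun w d => w ++ [d]) ih (Set.finite_Icc (0 : ℤ) ⌊β⌋)).subset ?_
    rintro _ ⟨x, hx, rfl⟩
    refine ⟨_, ⟨x, hx, rfl⟩, _, negBetaDigit_mem_Icc hβ hx n, ?_⟩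
    simp [negBetaWord, List.range_succ]

lemma mem_cylinder_iff {β x : ℝ} {w : List ℤ} :
    x ∈ cylinder β w ↔ x ∈ negBetaDom β ∧ negBetaWord β w.length x = w := by
  refine and_congr Iff.rfl ?_
  constructor
  · intro h
    refine List.ext_getElem (by simp [negBetaWord]) fun i hi hi' => ?_
    simp [negBetaWord, h i hi', hi']
  · intro h i hi
    conv_rhs => rw [← h]
    simp [negBetaWord, hi]

lemma setOf_cylinder_nonempty (β : ℝ) (n : ℕ) :
    {w : List ℤ | w.length = n ∧ (cylinder β w).Nonempty} = admissibleWords β n := by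
  ext w
  constructor
  · rintro ⟨rfl, x, hx⟩
    exact ⟨x, mem_cylinder_iff.1 hx⟩
  · rintro ⟨x, hx, rfl⟩
    exact ⟨by simp [negBetaWord], x, mem_cylinder_iff.2 ⟨hx, by simp [negBetaWord]⟩⟩

lemma Lnum'_le_Lnum {β : ℝ} (hβ : 1 < β) (n : ℕ) : Lnum' β n ≤ Lnum β n := by
  refine Set.ncard_le_ncard ?_ (by
    rw [setOf_cylinder_nonempty]
    exact admissibleWords_finite hβ n)
  rintro w ⟨hw, c, d, hcd, hsub, -⟩
  exact ⟨hw, (Set.nonempty_Ioo.2 hcd).mono hsub⟩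

lemma Finset.exists_pos_le_abs_sub (R : Finset ℝ) :
    ∃ δ : ℝ, 0 < δ ∧ ∀ x ∈ R, ∀ y ∈ R, x ≠ y → δ ≤ |x - y| := by
  rcases R.offDiag.eq_empty_or_nonempty with h | h
  · refine ⟨1, one_pos, fun x hx y hy hxy => ?_⟩
    have : (x, y) ∈ R.offDiag := Finset.mem_offDiag.2 ⟨hx, hy, hxy⟩
    simp [h] at this
  · obtain ⟨p, hp, hmin⟩ := R.offDiag.exists_min_image (fun p => |p.1 - p.2|) h
    refine ⟨|p.1 - p.2|, abs_pos.2 (sub_ne_zero.2 (Finset.mem_offDiag.1 hp).2.2),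
      fun x hx y hy hxy => hmin (x, y) (Finset.mem_offDiag.2 ⟨hx, hy, hxy⟩)⟩

/-- A set meeting at least four cylinders of a fixed length has diameter bounded below. -/
lemma exists_diam_lower_bound {β : ℝ} (hβ : 1 < β) (N : ℕ) :
    ∃ δ : ℝ, 0 < δ ∧ ∀ K ⊆ negBetaDom β, 3 < (negBetaWord β N '' K).ncard →
      ∃ x ∈ K, ∃ y ∈ K, δ ≤ |y - x| := by
  classical
  have hex : ∀ w : List ℤ, ∃ x : ℝ, w ∈ admissibleWords β N → negBetaWord β N x = w := by
    intro w
    by_cases hw : w ∈ admissibleWords β N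
    · obtain ⟨x, -, hx⟩ := hw
      exact ⟨x, fun _ => hx⟩
    · exact ⟨0, fun h => absurd h hw⟩
  choose r hr using hex
  obtain ⟨δ, hδ, hsep⟩ :=
    Finset.exists_pos_le_abs_sub ((admissibleWords_finite hβ N).toFinset.image r)
  refine ⟨δ, hδ, fun K hK hcard => ?_⟩
  obtain ⟨S, hSK, hinj⟩ := Set.SurjOn.exists_bijOn_subset (Set.surjOn_image (negBetaWord β N) K)
  rw [← hinj.image_eq, hinj.injOn.ncard_image] at hcard
  have hSfin : S.Finite := Set.finite_of_ncard_pos (by omega)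
  rw [Set.ncard_eq_toFinset_card S hSfin] at hcard
  obtain ⟨F, hFS, hF⟩ := Finset.exists_subset_card_eq (show 4 ≤ hSfin.toFinset.card from hcard)
  let k := F.orderEmbOfFin hF
  have hkS : ∀ i, k i ∈ S := fun i =>
    hSfin.mem_toFinset.1 (hFS (Finset.orderEmbOfFin_mem F hF i))
  have hne : ∀ i j, i ≠ j → negBetaWord β N (k i) ≠ negBetaWord β N (k j) := fun i j hij h =>
    hij (k.injective (hinj.injOn (hkS i) (hkS j) h))
  have hadm : ∀ i, negBetaWord β N (k i) ∈ admissibleWords β N := fun i =>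
    ⟨_, hK (hSK (hkS i)), rfl⟩
  have hmid : ∀ i, 0 < i → i < 3 → r (negBetaWord β N (k i)) ∈ Set.Icc (k 0) (k 3) := by
    intro i h0 h3
    have hri := hr _ (hadm i)
    constructor
    · by_contra! hlt
      exact hne 0 i h0.ne ((negBetaWord_eq_of_mem_Icc hβ hri
        ⟨hlt.le, k.monotone h0.le⟩).trans hri)
    · by_contra! hlt
      exact hne 3 i h3.ne' (negBetaWord_eq_of_mem_Icc hβ hri.symm
        ⟨k.monotone h3.le, hlt.le⟩)
  have hm1 := hmid 1 (by decide) (by decide)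
  have hm2 := hmid 2 (by decide) (by decide)
  have hmemR : ∀ i, r (negBetaWord β N (k i)) ∈
      (admissibleWords_finite hβ N).toFinset.image r := fun i =>
    Finset.mem_image_of_mem _ ((admissibleWords_finite hβ N).mem_toFinset.2 (hadm i))
  have hd := hsep _ (hmemR 1) _ (hmemR 2) fun h =>
    hne 1 2 (by decide) (by rw [← hr _ (hadm 1), ← hr _ (hadm 2), h])
  refine ⟨k 0, hSK (hkS 0), k 3, hSK (hkS 3), hd.trans ?_⟩
  refine le_trans ?_ (le_abs_self _)
  rw [abs_le]
  constructor <;> linarith [hm1.1, hm1.2, hm2.1, hm2.2]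

/-- The words of length `n` whose cylinder contains two points at distance at least `s`. -/
def wideWords (β : ℝ) (n : ℕ) (s : ℝ) : Set (List ℤ) :=
  {w | ∃ x ∈ negBetaDom β, ∃ y ∈ negBetaDom β,
    negBetaWord β n x = w ∧ negBetaWord β n y = w ∧ s ≤ |y - x|}

lemma wideWords_ncard_le {β : ℝ} (hβ : 1 < β) (n : ℕ) {s : ℝ} (hs : 0 < s) :
    ((wideWords β n s).ncard : ℝ) ≤ 2 / s + 3 := by
  have hgrid : ∀ w : List ℤ, ∃ m : ℤ, w ∈ wideWords β n s →
      negBetaWord β n (m * s) = w ∧ m * s ∈ negBetaDom β := by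
    intro w
    by_cases hw : w ∈ wideWords β n s
    · have hw' : ∃ x ∈ negBetaDom β, ∃ y ∈ negBetaDom β,
          negBetaWord β n x = w ∧ negBetaWord β n y = w ∧ s ≤ y - x := by
        obtain ⟨x, hx, y, hy, h1, h2, h3⟩ := hw
        rcases le_total x y with h | h
        · exact ⟨x, hx, y, hy, h1, h2, by rwa [abs_of_nonneg (by linarith)] at h3⟩
        · exact ⟨y, hy, x, hx, h2, h1, by rw [abs_of_nonpos (by linarith)] at h3; linarith⟩
      obtain ⟨x, hx, y, hy, h1, h2, h3⟩ := hw'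
      have a1 : ⌊y / s⌋ * s ≤ y := (le_div_iff₀ hs).1 (Int.floor_le (y / s))
      have a2 : y < (⌊y / s⌋ + 1) * s := (div_lt_iff₀ hs).1 (Int.lt_floor_add_one (y / s))
      have a3 : x ≤ ⌊y / s⌋ * s := by linarith
      exact ⟨⌊y / s⌋, fun _ => ⟨(negBetaWord_eq_of_mem_Icc hβ (h1.trans h2.symm) ⟨a3, a1⟩).trans h1,
        hx.1.trans a3, a1.trans_lt hy.2⟩⟩
    · exact ⟨0, fun h => absurd h hw⟩
  choose g hg using hgrid
  have hmaps : Set.MapsTo g (wideWords β n s) (Finset.Icc (-⌈1 / s⌉) ⌈1 / s⌉ : Finset ℤ) := by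
    intro w hw
    obtain ⟨-, h1, h2⟩ := hg w hw
    have b1 : -1 ≤ -β / (β + 1) := by
      rw [le_div_iff₀ (by linarith)]
      linarith
    have b2 : 1 / (β + 1) ≤ 1 := by
      rw [div_le_iff₀ (by linarith)]
      linarith
    have hc := (div_le_iff₀ hs).1 (Int.le_ceil (1 / s))
    simp only [Finset.coe_Icc, Set.mem_Icc]
    constructor
    · have : (-⌈1 / s⌉ : ℝ) ≤ g w := le_of_mul_le_mul_right (by linarith) hs
      exact_mod_cast this
    · have : (g w : ℝ) ≤ ⌈1 / s⌉ := le_of_mul_le_mul_right (by linarith) hs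
      exact_mod_cast this
  have hinj : Set.InjOn g (wideWords β n s) := fun v hv w hw h => by
    rw [← (hg v hv).1, ← (hg w hw).1, h]
  have hle := Set.ncard_le_ncard_of_injOn g hmaps hinj (Finset.finite_toSet _)
  rw [Set.ncard_coe_finset, Int.card_Icc] at hle
  have hpos : 0 < 1 / s := by positivity
  have hceil : 0 ≤ ⌈1 / s⌉ := Int.ceil_nonneg hpos.le
  have hle' : ((wideWords β n s).ncard : ℤ) ≤ 2 * ⌈1 / s⌉ + 1 := by omega
  have hle'' : ((wideWords β n s).ncard : ℝ) ≤ 2 * ⌈1 / s⌉ + 1 := by exact_mod_cast hle'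
  have := Int.ceil_lt_add_one (1 / s)
  have e : 2 / s = 2 * (1 / s) := by ring
  linarith

lemma admissibleWords_ncard_add_le {β : ℝ} (hβ : 1 < β) (N : ℕ) :
    ∃ E : ℝ, 0 < E ∧ ∀ n : ℕ, ((admissibleWords β (n + N)).ncard : ℝ) ≤
      3 * (admissibleWords β n).ncard + E * β ^ n := by
  classical
  obtain ⟨δ, hδ, hdiam⟩ := exists_diam_lower_bound hβ N
  set M := (admissibleWords β N).ncard
  refine ⟨(M + 1) * (2 / δ + 3), by positivity, fun n => ?_⟩
  have hpow : 1 ≤ β ^ n := one_le_pow₀ hβ.le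
  have hfin := admissibleWords_finite hβ n
  have hwfin : (wideWords β n (δ / β ^ n)).Finite := hfin.subset <| by
    rintro _ ⟨x, hx, -, -, rfl, -⟩
    exact ⟨x, hx, rfl⟩
  let fib : List ℤ → Set ℝ := fun w =>
    (negBetaT β)^[n] '' {x | x ∈ negBetaDom β ∧ negBetaWord β n x = w}
  have hfib : ∀ w, fib w ⊆ negBetaDom β := by
    rintro w _ ⟨x, hx, rfl⟩
    exact negBetaT_iterate_mem_dom hβ hx.1 n
  have hbound : ∀ w, (negBetaWord β N '' fib w).ncard ≤
      3 + if w ∈ wideWords β n (δ / β ^ n) then M else 0 := by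
    intro w
    by_cases h3 : 3 < (negBetaWord β N '' fib w).ncard
    · obtain ⟨_, ⟨x, ⟨hx, hxw⟩, rfl⟩, _, ⟨y, ⟨hy, hyw⟩, rfl⟩, hxy⟩ := hdiam _ (hfib w) h3
      rw [negBetaT_iterate_sub (hxw.trans hyw.symm), abs_mul, abs_pow, abs_neg,
        abs_of_pos (by linarith : 0 < β)] at hxy
      have hw : w ∈ wideWords β n (δ / β ^ n) :=
        ⟨x, hx, y, hy, hxw, hyw, by rwa [div_le_iff₀' (by positivity)]⟩
      rw [if_pos hw]
      exact (Set.ncard_le_ncard (Set.image_mono (hfib w)) (admissibleWords_finite hβ N)).trans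
        (Nat.le_add_left _ _)
    · omega
  have hsub : admissibleWords β (n + N) ⊆
      ⋃ w ∈ hfin.toFinset, (fun v => w ++ v) '' (negBetaWord β N '' fib w) := by
    rintro _ ⟨x, hx, rfl⟩
    simp only [Set.mem_iUnion]
    exact ⟨negBetaWord β n x, hfin.mem_toFinset.2 ⟨x, hx, rfl⟩, _,
      ⟨_, ⟨x, ⟨hx, rfl⟩, rfl⟩, rfl⟩, (negBetaWord_add β x n N).symm⟩
  have hffin : ∀ w, (negBetaWord β N '' fib w).Finite := fun w =>
    (admissibleWords_finite hβ N).subset (Set.image_mono (hfib w))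
  have hcount : (admissibleWords β (n + N)).ncard ≤
      3 * (admissibleWords β n).ncard + (wideWords β n (δ / β ^ n)).ncard * M := by
    calc (admissibleWords β (n + N)).ncard
        ≤ (⋃ w ∈ hfin.toFinset, (fun v => w ++ v) '' (negBetaWord β N '' fib w)).ncard :=
          Set.ncard_le_ncard hsub
            (hfin.toFinset.finite_toSet.biUnion fun w _ => (hffin w).image _)
      _ ≤ ∑ w ∈ hfin.toFinset, ((fun v => w ++ v) '' (negBetaWord β N '' fib w)).ncard :=
          Finset.set_ncard_biUnion_le _ _
      _ ≤ ∑ w ∈ hfin.toFinset, (3 + if w ∈ wideWords β n (δ / β ^ n) then M else 0) :=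
          Finset.sum_le_sum fun w _ => (Set.ncard_image_le (hffin w)).trans (hbound w)
      _ ≤ 3 * (admissibleWords β n).ncard + (wideWords β n (δ / β ^ n)).ncard * M := by
          rw [Finset.sum_add_distrib, ← Finset.sum_filter, Finset.sum_const, Finset.sum_const,
            Set.ncard_eq_toFinset_card _ hfin, Set.ncard_eq_toFinset_card _ hwfin,
            smul_eq_mul, smul_eq_mul, mul_comm 3]
          gcongr
          intro w hw
          exact hwfin.mem_toFinset.2 (Finset.mem_filter.1 hw).2
  have hwide := wideWords_ncard_le hβ n (s := δ / β ^ n) (by positivity)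
  have hwide' : ((wideWords β n (δ / β ^ n)).ncard : ℝ) ≤ (2 / δ + 3) * β ^ n := by
    have e : 2 / (δ / β ^ n) = 2 / δ * β ^ n := by field_simp
    rw [e] at hwide
    linarith
  calc ((admissibleWords β (n + N)).ncard : ℝ)
      ≤ 3 * (admissibleWords β n).ncard + (wideWords β n (δ / β ^ n)).ncard * M := by
        exact_mod_cast hcount
    _ ≤ 3 * (admissibleWords β n).ncard + ((2 / δ + 3) * β ^ n) * (M + 1) := by
        gcongr
        linarith
    _ = _ := by ring

lemma exists_admissibleWords_ncard_le {β : ℝ} (hβ : 1 < β) :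
    ∃ C : ℝ, 0 < C ∧ ∀ n : ℕ, ((admissibleWords β n).ncard : ℝ) ≤ C * β ^ n := by
  obtain ⟨N, hN⟩ := pow_unbounded_of_one_lt 4 hβ
  have hN0 : 0 < N := by
    rcases Nat.eq_zero_or_pos N with rfl | h
    · norm_num at hN
    · exact h
  obtain ⟨E, hE, hrec⟩ := admissibleWords_ncard_add_le hβ N
  let C : ℝ := E + ∑ j ∈ Finset.range N, ((admissibleWords β j).ncard : ℝ)
  have hEC : E ≤ C := le_add_of_nonneg_right (Finset.sum_nonneg fun _ _ => Nat.cast_nonneg _)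
  have hC : 0 < C := hE.trans_le hEC
  refine ⟨C, hC, fun n => ?_⟩
  induction n using Nat.strong_induction_on with
  | _ n ih =>
    rcases lt_or_ge n N with h | h
    · have h1 : ((admissibleWords β n).ncard : ℝ) ≤
          ∑ j ∈ Finset.range N, ((admissibleWords β j).ncard : ℝ) :=
        Finset.single_le_sum (f := fun j => ((admissibleWords β j).ncard : ℝ))
          (fun _ _ => Nat.cast_nonneg _) (Finset.mem_range.2 h)
      calc ((admissibleWords β n).ncard : ℝ) ≤ C := by linarith
        _ ≤ C * β ^ n := le_mul_of_one_le_right hC.le (one_le_pow₀ hβ.le)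
    · obtain ⟨m, rfl⟩ := Nat.exists_eq_add_of_le' h
      have hm := ih m (by omega)
      have hp : 0 < β ^ m := by positivity
      calc ((admissibleWords β (m + N)).ncard : ℝ)
          ≤ 3 * (admissibleWords β m).ncard + E * β ^ m := hrec m
        _ ≤ 3 * (C * β ^ m) + C * β ^ m := by gcongr
        _ = C * β ^ m * 4 := by ring
        _ ≤ C * β ^ m * β ^ N := by gcongr
        _ = C * β ^ (m + N) := by rw [pow_add]; ring

/-- there is C > 0 with L'_{β,n} ≤ C·β^n and L_{β,n} ≤ C·β^n. -/
theorem stmt_6 (β : ℝ) (hβ : 1 < β) :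
    ∃ C : ℝ, 0 < C ∧ ∀ n : ℕ, 1 ≤ n →
      (Lnum' β n : ℝ) ≤ C * β ^ n ∧ (Lnum β n : ℝ) ≤ C * β ^ n := by
  obtain ⟨C, hC, h⟩ := exists_admissibleWords_ncard_le hβ
  have hL : ∀ n, (Lnum β n : ℝ) ≤ C * β ^ n := fun n => by
    rw [Lnum, setOf_cylinder_nonempty]
    exact h n
  exact ⟨C, hC, fun n _ => ⟨(Nat.cast_le.2 (Lnum'_le_Lnum hβ n)).trans (hL n), hL n⟩⟩
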